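/- arXiv:2001.00743 — 2 statements merged into one kernel-verified Lean document; each statement's English description precedes it below -/
import Mathlib

section
/- Let k ≥ 3, 1 ≤ a ≤ k−3, m ≥ 1, and let λ = (m^a) be the rectangular partition with a rows of length m. For all a+1 ≤ a′ ≤ k−2 and all 0 ≤ j ≤ m, applying to T_λ first f̃_a^j, then f̃_{a+1}^j, …, then f̃_{a′+1}^j, and finally f̃_{a′} once, yields 0; that is, f̃_{a′} f̃_{a′+1}^j f̃_{a′}^j ⋯ f̃_{a+1}^j f̃_a^j (T_λ) = 0. -/
/-!
Semistandard Young tableaux are encoded by their "reading words"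
`w : ℕ → ℕ`:  the boxes of the shape `μ` are labelled `1, …, |μ|`, the boxes
of row `i` (`i = 1, 2, …`) receiving the labels
`μ₁ + ⋯ + μ_{i-1} + 1, …, μ₁ + ⋯ + μ_i`, increasing from right to left within
each row, and `w j` is the entry of the box labelled `j` (with `w j = 0`
outside the labels `1, …, |μ|`).  A vanished tableau (`0`) is represented by
`none : Option (ℕ → ℕ)`.
-/

namespace CST

/-- `μ₁ + ⋯ + μ_r`. -/
def shapePrefix (μ : List ℕ) (r : ℕ) : ℕ := (μ.take r).sum

/-- The entry of the filling with reading word `w` in row `r + 1` and column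
`c` (columns numbered from the left, `1 ≤ c ≤ μ_{r+1}`). -/
def entryAt (μ : List ℕ) (w : ℕ → ℕ) (r c : ℕ) : ℕ :=
  w (shapePrefix μ r + μ.getD r 0 + 1 - c)

/-- `w` is the reading word of a semistandard Young tableau of shape `μ` with
entries in `{1, …, k}`: entries lie in `{1, …, k}`, rows weakly increase,
columns strictly increase, and `w` vanishes outside the labels `1, …, |μ|`. -/
def IsSSYT (μ : List ℕ) (k : ℕ) (w : ℕ → ℕ) : Prop :=
  (∀ r c, r < μ.length → 1 ≤ c → c ≤ μ.getD r 0 →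
      1 ≤ entryAt μ w r c ∧ entryAt μ w r c ≤ k) ∧
  (∀ r c, r < μ.length → 1 ≤ c → c < μ.getD r 0 →
      entryAt μ w r c ≤ entryAt μ w r (c + 1)) ∧
  (∀ r c, r + 1 < μ.length → 1 ≤ c → c ≤ μ.getD (r + 1) 0 →
      entryAt μ w r c < entryAt μ w (r + 1) c) ∧
  (∀ j, j = 0 ∨ μ.sum < j → w j = 0)

/-- One step of the bracketing procedure for the letters `i, i + 1`:  `acc`
is the stack of labels of currently unmatched letters `i` (most recent
first); a letter `i + 1` matches (and removes) the most recent unmatched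
`i`. -/
def scanStep (i : ℕ) (w : ℕ → ℕ) (acc : List ℕ) (j : ℕ) : List ℕ :=
  if w j = i then j :: acc
  else if w j = i + 1 then acc.drop 1
  else acc

/-- The labels of the unmatched letters `i` of `w` after the iterated removal
of consecutive pairs `i … i+1` (scanning the labels `1, …, n` in order). -/
def unmatched (n i : ℕ) (w : ℕ → ℕ) : List ℕ :=
  ((List.range n).map (· + 1)).foldl (scanStep i w) []

/-- The Kashiwara lowering operator `f̃ᵢ` on fillings with `n` boxes:  if
some letter `i` is unmatched, change the one with the smallest label to
`i + 1`; otherwise the result is `0` (i.e. `none`). -/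
def fTilde (n i : ℕ) : Option (ℕ → ℕ) → Option (ℕ → ℕ)
  | none => none
  | some w =>
    match (unmatched n i w).min? with
    | none => none
    | some j => some (Function.update w j (i + 1))

/-- `f̃_{a'}^{c_{a'}} ⋯ f̃_{a+1}^{c_{a+1}} f̃_a^{c_a} T`. -/
def chainPow (n : ℕ) (c : ℕ → ℕ) (a a' : ℕ) (T : Option (ℕ → ℕ)) : Option (ℕ → ℕ) :=
  (List.range (a' + 1 - a)).foldl (fun t r => (fTilde n (a + r))^[c (a + r)] t) T

/-- `f̃_{i_r} ⋯ f̃_{i_1} T` for `is = [i_1, …, i_r]`. -/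
def applySeq (n : ℕ) (is : List ℕ) (T : Option (ℕ → ℕ)) : Option (ℕ → ℕ) :=
  is.foldl (fun t i => fTilde n i t) T

/-- The highest weight tableau `T_μ`: every entry of row `i` equals `i`. -/
def highestWord (μ : List ℕ) (j : ℕ) : ℕ :=
  if 1 ≤ j ∧ j ≤ μ.sum then
    ((List.range μ.length).filter fun r => shapePrefix μ (r + 1) < j).length + 1
  else 0

theorem unmatched_succ (n i : ℕ) (w : ℕ → ℕ) :
    unmatched (n + 1) i w = scanStep i w (unmatched n i w) (n + 1) := by
  simp [unmatched, List.range_succ, List.foldl_append]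

theorem unmatched_eq_nil {n i : ℕ} {w : ℕ → ℕ} (h : ∀ p, 1 ≤ p → p ≤ n → w p ≠ i) :
    unmatched n i w = [] := by
  induction n with
  | zero => rfl
  | succ n ih =>
    rw [unmatched_succ, ih fun p h1 h2 => h p h1 (by omega), scanStep,
      if_neg (h (n + 1) (by omega) le_rfl)]
    simp

/-- If the first `i` has label `B + 1` and no `i + 1` follows it, then it is unmatched, and is the
unmatched `i` of smallest label. -/
theorem min?_unmatched {n i B : ℕ} {w : ℕ → ℕ} (hB : B + 1 ≤ n)
    (h_before : ∀ p, 1 ≤ p → p ≤ B → w p ≠ i) (h_at : w (B + 1) = i)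
    (h_after : ∀ p, B < p → w p ≠ i + 1) :
    (unmatched n i w).min? = some (B + 1) := by
  rw [List.min?_eq_some_iff]
  induction n, hB using Nat.le_induction with
  | base => simp [unmatched_succ, unmatched_eq_nil h_before, scanStep, h_at]
  | succ n hn ih =>
    rw [unmatched_succ, scanStep, if_neg (h_after (n + 1) (by omega))]
    split_ifs
    · refine ⟨List.mem_cons_of_mem _ ih.1, fun b hb => ?_⟩
      rcases List.mem_cons.1 hb with rfl | hb
      · omega
      · exact ih.2 b hb
    · exact ih

theorem iterate_fTilde {n i B j t : ℕ} {w : ℕ → ℕ} (hn : B + j ≤ n)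
    (h_before : ∀ p, 1 ≤ p → p ≤ B → w p ≠ i) (h_block : ∀ p, B < p → p ≤ B + j → w p = i)
    (h_after : ∀ p, B < p → w p ≠ i + 1) (ht : t ≤ j) :
    (fTilde n i)^[t] (some w) = some fun p => if B < p ∧ p ≤ B + t then i + 1 else w p := by
  induction t with
  | zero =>
    have (p : ℕ) : ¬(B < p ∧ p ≤ B + 0) := by omega
    simp only [this, if_false, Function.iterate_zero, id]
  | succ t ih =>
    rw [Function.iterate_succ_apply', ih (by omega)]
    have h_min := min?_unmatched (n := n) (i := i) (B := B + t)
      (w := fun p => if B < p ∧ p ≤ B + t then i + 1 else w p) (by omega)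
      (fun p h1 h2 => by
        by_cases hp : B < p
        · simp [hp, h2]
        · simpa [hp] using h_before p h1 (by omega))
      (by simpa using h_block (B + t + 1) (by omega) (by omega))
      (fun p hp => by simpa [hp.not_ge] using h_after p (by omega))
    simp only [fTilde, h_min, Option.some.injEq]
    funext p
    by_cases hp : p = B + t + 1
    · subst hp
      simp [Nat.add_assoc]
    · rw [Function.update_of_ne hp]
      congr 1
      exact propext (by omega)

theorem shapePrefix_replicate {a m r : ℕ} (hr : r ≤ a) :
    shapePrefix (List.replicate a m) r = r * m := by
  simp [shapePrefix, hr]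

theorem highestWord_replicate_le (a m p : ℕ) :
    highestWord (List.replicate (a + 1) m) p ≤ a + 1 := by
  have h := List.length_filter_le
    (fun r => decide (shapePrefix (List.replicate (a + 1) m) (r + 1) < p)) (List.range a)
  rw [List.length_range] at h
  rw [highestWord]
  split_ifs with hp
  · have h_last : ¬shapePrefix (List.replicate (a + 1) m) (a + 1) < p := by
      rw [shapePrefix_replicate le_rfl]
      simpa using hp.2
    simpa [List.range_succ, h_last] using h
  · omega

theorem highestWord_replicate_le_of_le {a m p : ℕ} (hp : p ≤ a * m) :
    highestWord (List.replicate (a + 1) m) p ≤ a := by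
  rcases a with _ | a
  · simp [highestWord, show p = 0 by omega]
  have h := List.length_filter_le
    (fun r => decide (shapePrefix (List.replicate (a + 1 + 1) m) (r + 1) < p)) (List.range a)
  rw [List.length_range] at h
  rw [highestWord]
  split_ifs with hp'
  · have h_last : ¬shapePrefix (List.replicate (a + 1 + 1) m) (a + 1 + 1) < p := by
      rw [shapePrefix_replicate le_rfl]
      simpa using hp'.2
    have h_prev : ¬shapePrefix (List.replicate (a + 1 + 1) m) (a + 1) < p := by
      rw [shapePrefix_replicate (by omega)]
      omega
    simpa [List.range_succ, h_last, h_prev] using h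
  · omega

theorem highestWord_replicate_last_row {a m p : ℕ} (hp : a * m < p) (hp' : p ≤ (a + 1) * m) :
    highestWord (List.replicate (a + 1) m) p = a + 1 := by
  have h_last : ¬shapePrefix (List.replicate (a + 1) m) (a + 1) < p := by
    rw [shapePrefix_replicate le_rfl]
    omega
  have h_filter : (List.range a).filter
      (fun r => decide (shapePrefix (List.replicate (a + 1) m) (r + 1) < p)) = List.range a := by
    rw [List.filter_eq_self]
    intro r hr
    rw [List.mem_range] at hr
    rw [shapePrefix_replicate (by omega), decide_eq_true_iff]
    exact (Nat.mul_le_mul_right m hr).trans_lt hp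
  rw [highestWord, if_pos (by simp; omega)]
  simp [List.range_succ, h_last, h_filter]

/-- After `s` blocks of lowering operators, the first `j` labels of the last row carry the letter
`a + 1 + s`, and all other entries are unchanged. -/
theorem foldl_fTilde_highestWord {a m j : ℕ} (hj : j ≤ m) (s : ℕ) :
    (List.range s).foldl (fun t r => (fTilde ((a + 1) * m) (a + 1 + r))^[j] t)
        (some (highestWord (List.replicate (a + 1) m))) =
      some fun p => if a * m < p ∧ p ≤ a * m + j then a + 1 + s
        else highestWord (List.replicate (a + 1) m) p := by
  have h_size : (a + 1) * m = a * m + m := by ring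
  induction s with
  | zero =>
    simp only [List.range_zero, List.foldl_nil, Option.some.injEq]
    funext p
    split_ifs with hp
    · exact highestWord_replicate_last_row hp.1 (by omega)
    · rfl
  | succ s ih =>
    rw [List.range_succ, List.foldl_append, ih, List.foldl_cons, List.foldl_nil,
      iterate_fTilde (B := a * m) (j := j) (by omega) _ _ _ le_rfl]
    · rw [Option.some.injEq]
      funext p
      split_ifs <;> rfl
    · intro p _ hp
      have := highestWord_replicate_le_of_le hp
      rw [if_neg (by omega)]
      omega
    · intro p hp hp'
      rw [if_pos ⟨hp, hp'⟩]
    · intro p _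
      have := highestWord_replicate_le a m p
      split_ifs <;> omega

/-- Lemma `zero` (2):  for the rectangular shape
`λ = (m^a)` (`1 ≤ a ≤ k - 3`), `a + 1 ≤ a' ≤ k - 2` and `0 ≤ j ≤ m`,
`f̃_{a'} f̃_{a'+1}^j f̃_{a'}^j ⋯ f̃_{a+1}^j f̃_a^j (T_λ) = 0`. -/
theorem extra_lowering_kills_tableau
    (k a m a' j : ℕ) (hk : 3 ≤ k) (ha : 1 ≤ a) (hak : a ≤ k - 3) (hm : 1 ≤ m)
    (haa' : a + 1 ≤ a') (ha'k : a' ≤ k - 2) (hj : j ≤ m) :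
    fTilde (a * m) a'
      (chainPow (a * m) (fun _ => j) a (a' + 1)
        (some (highestWord (List.replicate a m)))) = none := by
  obtain ⟨b, rfl⟩ := Nat.exists_eq_add_of_le' ha
  rw [chainPow, foldl_fTilde_highestWord hj, fTilde, unmatched_eq_nil]
  · rfl
  · intro p _ _
    have := highestWord_replicate_le b m p
    split_ifs <;> omega

end CST
end

section
/- Let k ≥ 3, 1 ≤ a ≤ k−2, m ≥ 1, and let V^λ be an irreducible highest weight U_q(sl_k)-module with highest weight λ = mω_a and highest weight vector v_λ. For all a ≤ a′ ≤ k−2 and all 0 ≤ j ≤ m: e_{a′} f_{a′+1}^{(j)} f_{a′}^{(j)} ⋯ f_{a+1}^{(j)} f_a^{(j)} v_λ = 0. -/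
/-!
Common setup: the quantum group `U_q(sl_k)` (presented by generators
`e_i, f_i, K_i = q^{h_i}, K_i⁻¹` for `1 ≤ i ≤ k-1` and the standard relations)
over the field `KK = ℚ(q)`, and the notion of an irreducible highest weight
module.  Weights are recorded as functions `μ : ℕ → ℤ`, `μ i` being the value
`μ(h_i)` on the `i`-th simple coroot.
-/

noncomputable section
namespace QSL

abbrev KK : Type := RatFunc ℚ

/-- the variable `q`. -/
def qv : KK := RatFunc.X

/-- the quantum integer `[n]_q = (qⁿ - q⁻ⁿ)/(q - q⁻¹)`. -/
def qInt (n : ℕ) : KK := (qv ^ n - qv⁻¹ ^ n) / (qv - qv⁻¹)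

/-- the quantum factorial `[n]_q!`. -/
def qFact : ℕ → KK
  | 0 => 1
  | n + 1 => qFact n * qInt (n + 1)

/-- the Gaussian binomial coefficient `[m choose j]_q`. -/
def qBinom (m j : ℕ) : KK :=
  (∏ t ∈ Finset.range j, qInt (m - t)) / (∏ t ∈ Finset.range j, qInt (j - t))

/-- the Cartan matrix of `sl`:  `cartan i j = αⱼ(h_i)`. -/
def cartan (i j : ℕ) : ℤ := if i = j then 2 else if i + 1 = j ∨ j + 1 = i then -1 else 0

/-- The quantum group with `d` nodes (`d = k - 1` for `U_q(sl_k)`): a unital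
associative `ℚ(q)`-algebra generated by elements `e i, f i, K i, Kinv i`
(`1 ≤ i ≤ d`, where `K i = q^{h_i}`) subject to the standard relations. -/
structure QGroup (d : ℕ) where
  U : Type
  [ring : Ring U]
  [alg : Algebra KK U]
  e : ℕ → U
  f : ℕ → U
  K : ℕ → U
  Kinv : ℕ → U
  K_mul_Kinv : ∀ i, 1 ≤ i → i ≤ d → K i * Kinv i = 1
  Kinv_mul_K : ∀ i, 1 ≤ i → i ≤ d → Kinv i * K i = 1
  K_comm : ∀ i j, 1 ≤ i → i ≤ d → 1 ≤ j → j ≤ d → K i * K j = K j * K i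
  K_e_Kinv : ∀ i j, 1 ≤ i → i ≤ d → 1 ≤ j → j ≤ d →
      K i * e j * Kinv i = (qv ^ cartan i j) • e j
  K_f_Kinv : ∀ i j, 1 ≤ i → i ≤ d → 1 ≤ j → j ≤ d →
      K i * f j * Kinv i = (qv ^ (-cartan i j)) • f j
  e_f_comm : ∀ i j, 1 ≤ i → i ≤ d → 1 ≤ j → j ≤ d →
      e i * f j - f j * e i = if i = j then (qv - qv⁻¹)⁻¹ • (K i - Kinv i) else 0
  serre_e : ∀ i j, 1 ≤ i → i ≤ d → 1 ≤ j → j ≤ d → (i + 1 = j ∨ j + 1 = i) →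
      e i * e i * e j - (qv + qv⁻¹) • (e i * e j * e i) + e j * e i * e i = 0
  serre_f : ∀ i j, 1 ≤ i → i ≤ d → 1 ≤ j → j ≤ d → (i + 1 = j ∨ j + 1 = i) →
      f i * f i * f j - (qv + qv⁻¹) • (f i * f j * f i) + f j * f i * f i = 0
  comm_e : ∀ i j, 1 ≤ i → i ≤ d → 1 ≤ j → j ≤ d → (i + 1 < j ∨ j + 1 < i) →
      e i * e j = e j * e i
  comm_f : ∀ i j, 1 ≤ i → i ≤ d → 1 ≤ j → j ≤ d → (i + 1 < j ∨ j + 1 < i) →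
      f i * f j = f j * f i
  gen : ∀ x : U, x ∈ Algebra.adjoin KK
      {y : U | ∃ i, 1 ≤ i ∧ i ≤ d ∧ (y = e i ∨ y = f i ∨ y = K i ∨ y = Kinv i)}

attribute [instance] QGroup.ring QGroup.alg

variable {d : ℕ} (G : QGroup d)

/-- the divided power `f_i^{(n)} = f_iⁿ/[n]_q!`. -/
def fDiv (i n : ℕ) : G.U := (qFact n)⁻¹ • (G.f i) ^ n

/-- the divided power `e_i^{(n)} = e_iⁿ/[n]_q!`. -/
def eDiv (i n : ℕ) : G.U := (qFact n)⁻¹ • (G.e i) ^ n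

variable {V : Type} [AddCommGroup V] [Module KK V] [Module G.U V] [IsScalarTower KK G.U V]

/-- `u` is a weight vector of weight `μ` (recorded via `μ i = μ(h_i)`). -/
def IsWtVec (u : V) (μ : ℕ → ℤ) : Prop :=
  ∀ i, 1 ≤ i → i ≤ d → G.K i • u = (qv ^ μ i) • u

/-- `V` is an irreducible highest weight module over `G` with highest weight
`lam` and highest weight vector `v`: it is finite dimensional over `ℚ(q)`,
has a weight space decomposition, `v` is a nonzero weight vector of weight
`lam` annihilated by the `e_i`, `V` is generated by `v`, and `V` is
irreducible. -/
structure IsHWModule (lam : ℕ → ℤ) (v : V) : Prop where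
  findim : FiniteDimensional KK V
  ne_zero : v ≠ 0
  wt : IsWtVec G v lam
  hw : ∀ i, 1 ≤ i → i ≤ d → G.e i • v = 0
  gen : ∀ w : V, ∃ p : G.U, p • v = w
  irred : ∀ W : Submodule G.U V, W = ⊥ ∨ W = ⊤
  decomp : Submodule.span KK {u : V | ∃ μ : ℕ → ℤ, IsWtVec G u μ} = ⊤

/-- the weight `m ω_a`. -/
def omWt (a m : ℕ) : ℕ → ℤ := fun i => if i = a then (m : ℤ) else 0

/-- the weight `j ω_{a-1} + (m - j) ω_a`. -/
def hookWt (a m j : ℕ) : ℕ → ℤ := fun i =>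
  (if i = a - 1 then (j : ℤ) else 0) + (if i = a then (m : ℤ) - (j : ℤ) else 0)

/-- `f_{a'}^{(c_{a'})} ⋯ f_{a+1}^{(c_{a+1})} f_a^{(c_a)} • v`. -/
def fDivChain (c : ℕ → ℕ) (a a' : ℕ) (v : V) : V :=
  (List.range (a' + 1 - a)).foldl (fun u r => fDiv G (a + r) (c (a + r)) • u) v

theorem qv_ne_zero : qv ≠ 0 := RatFunc.X_ne_zero

theorem qv_pow_ne_one {n : ℕ} (hn : n ≠ 0) : qv ^ n ≠ 1 := by
  intro h
  have h1 : algebraMap (Polynomial ℚ) KK (Polynomial.X ^ n) = algebraMap _ _ 1 := by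
    rw [map_pow, RatFunc.algebraMap_X, map_one]
    exact h
  have h2 := congrArg Polynomial.natDegree (RatFunc.algebraMap_injective ℚ h1)
  simp at h2
  exact hn h2

theorem qv_zpow_ne_one {n : ℤ} (hn : n ≠ 0) : qv ^ n ≠ 1 := by
  obtain ⟨k, rfl | rfl⟩ := n.eq_nat_or_neg
  · rw [zpow_natCast]
    exact qv_pow_ne_one (by omega)
  · rw [zpow_neg, zpow_natCast, ne_eq, inv_eq_one]
    exact qv_pow_ne_one (by omega)

theorem qv_zpow_injective : Function.Injective (fun n : ℤ => qv ^ n) := by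
  intro m n h
  by_contra hne
  refine qv_zpow_ne_one (n := m - n) (by omega) ?_
  rw [zpow_sub₀ qv_ne_zero, div_eq_one_iff_eq (zpow_ne_zero _ qv_ne_zero)]
  exact h

theorem qv_zpow_sub_zpow_neg_ne_zero {n : ℤ} (hn : n ≠ 0) : qv ^ n - qv ^ (-n) ≠ 0 := by
  rw [sub_ne_zero]
  exact fun h => hn (by have := qv_zpow_injective h; omega)

theorem qv_sub_inv_ne_zero : qv - qv⁻¹ ≠ 0 := by
  simpa using qv_zpow_sub_zpow_neg_ne_zero (n := 1) one_ne_zero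

/-- The scalar `[s+1]_q [n-s]_q` by which `e f^(s+1)` and `f^s` differ on a highest weight
vector of weight `n`. -/
def raiseCoeff (n : ℤ) (s : ℕ) : KK :=
  (qv ^ (s + 1 : ℤ) - qv ^ (-(s + 1 : ℤ))) * (qv ^ (n - s) - qv ^ (-(n - s))) / (qv - qv⁻¹) ^ 2

theorem raiseCoeff_ne_zero {n : ℤ} {s : ℕ} (h : n ≠ s) : raiseCoeff n s ≠ 0 :=
  div_ne_zero
    (mul_ne_zero (qv_zpow_sub_zpow_neg_ne_zero (by omega))
      (qv_zpow_sub_zpow_neg_ne_zero (by omega)))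
    (pow_ne_zero _ qv_sub_inv_ne_zero)

theorem raiseCoeff_zero (n : ℤ) :
    raiseCoeff n 0 = (qv - qv⁻¹)⁻¹ * (qv ^ n - qv ^ (-n)) := by
  have := qv_sub_inv_ne_zero
  simp only [raiseCoeff, Nat.cast_zero, zero_add, sub_zero, zpow_one, zpow_neg]
  field_simp

theorem raiseCoeff_succ (n : ℤ) (s : ℕ) :
    raiseCoeff n (s + 1) = raiseCoeff n s +
      (qv - qv⁻¹)⁻¹ * (qv ^ (n - 2 * (s + 1 : ℕ)) - qv ^ (-(n - 2 * (s + 1 : ℕ)))) := by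
  have h := qv_sub_inv_ne_zero
  have h0 := qv_ne_zero
  have key : (qv ^ ((s + 1 : ℕ) + 1 : ℤ) - qv ^ (-((s + 1 : ℕ) + 1 : ℤ))) *
        (qv ^ (n - (s + 1 : ℕ)) - qv ^ (-(n - (s + 1 : ℕ)))) =
      (qv ^ (s + 1 : ℤ) - qv ^ (-(s + 1 : ℤ))) * (qv ^ (n - s) - qv ^ (-(n - s))) +
      (qv - qv⁻¹) * (qv ^ (n - 2 * (s + 1 : ℕ)) - qv ^ (-(n - 2 * (s + 1 : ℕ)))) := by
    have hN := zpow_ne_zero n h0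
    have hS := pow_ne_zero s h0
    have e (x : ℕ) : n - 2 * (x : ℤ) = n - x - x := by ring
    rw [e]
    simp only [neg_sub, neg_add_rev, Nat.cast_add, Nat.cast_one, zpow_add₀ h0, zpow_sub₀ h0,
      zpow_neg, zpow_natCast, zpow_one]
    field_simp
    ring
  rw [raiseCoeff, key, raiseCoeff]
  field_simp

variable {G}

theorem K_smul_f_smul {i l : ℕ} (hi : 1 ≤ i) (hid : i ≤ d) (hl : 1 ≤ l) (hld : l ≤ d)
    {u : V} {n : ℤ} (hK : G.K i • u = qv ^ n • u) :
    G.K i • G.f l • u = qv ^ (n - cartan i l) • G.f l • u := by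
  have h1 : G.K i * G.f l = (qv ^ (-cartan i l)) • (G.f l * G.K i) := by
    have := congrArg (· * G.K i) (G.K_f_Kinv i l hi hid hl hld)
    simpa [mul_assoc, G.Kinv_mul_K i hi hid] using this
  rw [← mul_smul, h1, smul_assoc, mul_smul, hK, smul_comm (G.f l), smul_smul,
    ← zpow_add₀ qv_ne_zero]
  congr 2
  ring

theorem K_smul_f_pow_smul {i l : ℕ} (hi : 1 ≤ i) (hid : i ≤ d) (hl : 1 ≤ l) (hld : l ≤ d)
    {u : V} {n : ℤ} (hK : G.K i • u = qv ^ n • u) (s : ℕ) :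
    G.K i • G.f l ^ s • u = qv ^ (n - s * cartan i l) • G.f l ^ s • u := by
  induction s with
  | zero => simpa using hK
  | succ s ih =>
    rw [pow_succ', mul_smul, K_smul_f_smul hi hid hl hld ih]
    congr 2
    push_cast
    ring

theorem Kinv_smul {i : ℕ} (hi : 1 ≤ i) (hid : i ≤ d) {u : V} {n : ℤ}
    (hK : G.K i • u = qv ^ n • u) : G.Kinv i • u = qv ^ (-n) • u := by
  have h : u = qv ^ n • G.Kinv i • u := by
    rw [smul_comm, ← hK, ← mul_smul, G.Kinv_mul_K i hi hid, one_smul]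
  nth_rewrite 2 [h]
  rw [smul_smul, ← zpow_add₀ qv_ne_zero, neg_add_cancel, zpow_zero, one_smul]

theorem e_smul_f_smul {i : ℕ} (hi : 1 ≤ i) (hid : i ≤ d) {u : V} {n : ℤ}
    (hK : G.K i • u = qv ^ n • u) :
    G.e i • G.f i • u =
      G.f i • G.e i • u + ((qv - qv⁻¹)⁻¹ * (qv ^ n - qv ^ (-n))) • u := by
  have h := G.e_f_comm i i hi hid hi hid
  rw [if_pos rfl, sub_eq_iff_eq_add'] at h
  rw [← mul_smul, h, add_smul, smul_assoc, sub_smul, hK, Kinv_smul hi hid hK,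
    ← sub_smul, mul_smul, mul_smul]

theorem e_smul_f_pow_succ_smul {i : ℕ} (hi : 1 ≤ i) (hid : i ≤ d) {u : V} {n : ℤ}
    (hK : G.K i • u = qv ^ n • u) (he : G.e i • u = 0) (s : ℕ) :
    G.e i • G.f i ^ (s + 1) • u = raiseCoeff n s • G.f i ^ s • u := by
  induction s with
  | zero => simp [e_smul_f_smul hi hid hK, he, raiseCoeff_zero]
  | succ s ih =>
    have hK' := K_smul_f_pow_smul hi hid hi hid hK (s + 1)
    rw [pow_succ' _ (s + 1), mul_smul, e_smul_f_smul hi hid hK', ih, smul_comm, ← mul_smul,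
      ← pow_succ', ← add_smul, raiseCoeff_succ]
    simp [cartan, mul_comm]

/-- In a finite-dimensional module, `f^(n+1)` kills a highest weight vector of weight `n`. -/
theorem f_pow_succ_smul_eq_zero [FiniteDimensional KK V] {i : ℕ} (hi : 1 ≤ i) (hid : i ≤ d)
    {u : V} {n : ℕ} (hK : G.K i • u = qv ^ (n : ℤ) • u) (he : G.e i • u = 0) :
    G.f i ^ (n + 1) • u = 0 := by
  by_contra hne
  have hall : ∀ t : ℕ, G.f i ^ (n + 1 + t) • u ≠ 0 := by
    intro t
    induction t with
    | zero => exact hne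
    | succ t ih =>
      intro h0
      have h := e_smul_f_pow_succ_smul hi hid hK he (n + 1 + t)
      rw [add_assoc (n + 1), h0, smul_zero] at h
      exact smul_ne_zero (raiseCoeff_ne_zero (by omega)) ih h.symm
  let T : Module.End KK V := Algebra.lsmul KK KK V (G.K i)
  have hT : ∀ t : ℕ, T.HasEigenvalue (qv ^ ((n : ℤ) - (n + 1 + t : ℕ) * cartan i i)) := fun t =>
    Module.End.hasEigenvalue_of_hasEigenvector
      ⟨Module.End.mem_eigenspace_iff.mpr (K_smul_f_pow_smul hi hid hi hid hK _), hall t⟩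
  have hinj : Function.Injective
      (fun t : ℕ => qv ^ ((n : ℤ) - (n + 1 + t : ℕ) * cartan i i)) := by
    intro s t hst
    have := qv_zpow_injective hst
    simp only [cartan, if_true] at this
    omega
  exact Set.infinite_of_injective_forall_mem hinj hT T.finite_hasEigenvalue

theorem e_smul_f_pow_smul_of_ne {W : Type} [AddCommGroup W] [Module G.U W]
    {i l : ℕ} (hi : 1 ≤ i) (hid : i ≤ d) (hl : 1 ≤ l) (hld : l ≤ d)
    (hil : i ≠ l) (s : ℕ) (u : W) : G.e i • G.f l ^ s • u = G.f l ^ s • G.e i • u := by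
  have h : Commute (G.e i) (G.f l) := by
    have := G.e_f_comm i l hi hid hl hld
    rwa [if_neg hil, sub_eq_zero] at this
  rw [← mul_smul, (h.pow_right s).eq, mul_smul]

theorem fDiv_smul (i s : ℕ) (u : V) : fDiv G i s • u = (qFact s)⁻¹ • G.f i ^ s • u :=
  smul_assoc _ _ _

theorem fDivChain_succ {W : Type} [AddCommGroup W] [Module G.U W] (c : ℕ → ℕ)
    {a b : ℕ} (hab : a ≤ b + 1) (v : W) :
    fDivChain G c a (b + 1) v = fDiv G (b + 1) (c (b + 1)) • fDivChain G c a b v := by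
  obtain ⟨r, hr⟩ := Nat.exists_eq_add_of_le hab
  simp only [fDivChain, hr, Nat.add_assoc, Nat.add_sub_cancel_left, List.range_succ,
    List.foldl_append, List.foldl_cons, List.foldl_nil]

theorem fDivChain_self {W : Type} [AddCommGroup W] [Module G.U W] (c : ℕ → ℕ)
    (a : ℕ) (v : W) :
    fDivChain G c a a v = fDiv G a (c a) • v := by
  simp [fDivChain]

theorem e_smul_fDivChain_eq_zero (c : ℕ → ℕ) {a b i : ℕ} {v : V}
    (hv : ∀ l, 1 ≤ l → l ≤ d → G.e l • v = 0) (ha : 1 ≤ a) (hab : a ≤ b) (hbi : b < i)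
    (hid : i ≤ d) : G.e i • fDivChain G c a b v = 0 := by
  induction b, hab using Nat.le_induction with
  | base =>
    rw [fDivChain_self, fDiv_smul, smul_comm,
      e_smul_f_pow_smul_of_ne (by omega) hid ha (by omega) (by omega), hv i (by omega) hid]
    simp
  | succ b hab ih =>
    rw [fDivChain_succ c (by omega), fDiv_smul, smul_comm,
      e_smul_f_pow_smul_of_ne (by omega) hid (by omega) (by omega) (by omega), ih (by omega)]
    simp

theorem K_smul_fDivChain (c : ℕ → ℕ) {a b i : ℕ} {v : V}
    (hv : ∀ l, a < l → l ≤ d → G.K l • v = v) (ha : 1 ≤ a) (hab : a ≤ b) (hbi : b < i)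
    (hid : i ≤ d) : G.K i • fDivChain G c a b v =
      qv ^ (if i = b + 1 then (c b : ℤ) else 0) • fDivChain G c a b v := by
  have hcart : ∀ b, b < i → -((c b : ℤ) * cartan i b) = if i = b + 1 then (c b : ℤ) else 0 := by
    intro b hb
    unfold cartan
    split_ifs <;> omega
  induction b, hab using Nat.le_induction with
  | base =>
    have h : G.K i • v = qv ^ (0 : ℤ) • v := by rw [hv i hbi hid, zpow_zero, one_smul]
    rw [fDivChain_self, fDiv_smul, smul_comm,
      K_smul_f_pow_smul (by omega) hid ha (by omega) h, zero_sub, hcart a hbi, smul_comm]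
  | succ b hab ih =>
    have h := ih (by omega)
    rw [if_neg (by omega)] at h
    rw [fDivChain_succ c (by omega), fDiv_smul, smul_comm,
      K_smul_f_pow_smul (by omega) hid (by omega) (by omega) h, zero_sub, hcart _ hbi, smul_comm]

/-- If `w` is killed by `e_b` and `e_(b+1)` and has weight zero at node `b+1`, then
`e_b` kills `f_(b+1)^(j) f_b^(j) w`. -/
theorem e_smul_fDiv_fDiv_smul_eq_zero [FiniteDimensional KK V] {b : ℕ} (hb : 1 ≤ b)
    (hbd : b + 1 ≤ d) {w : V} {n : ℤ} (hK : G.K b • w = qv ^ n • w)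
    (hK' : G.K (b + 1) • w = w) (he : G.e b • w = 0) (he' : G.e (b + 1) • w = 0) (j : ℕ) :
    G.e b • fDiv G (b + 1) j • fDiv G b j • w = 0 := by
  rw [fDiv_smul, fDiv_smul, smul_comm,
    e_smul_f_pow_smul_of_ne hb (by omega) (by omega) hbd (by omega), smul_comm (G.e b)]
  cases j with
  | zero => simp [he]
  | succ s =>
    have h0 : G.K (b + 1) • w = qv ^ (0 : ℤ) • w := by rw [hK', zpow_zero, one_smul]
    have hw : G.K (b + 1) • G.f b ^ s • w = qv ^ (s : ℤ) • G.f b ^ s • w := by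
      rw [K_smul_f_pow_smul (by omega) hbd hb (by omega) h0]
      simp [cartan]
    have hew : G.e (b + 1) • G.f b ^ s • w = 0 := by
      rw [e_smul_f_pow_smul_of_ne (by omega) hbd hb (by omega) (by omega), he', smul_zero]
    rw [e_smul_f_pow_succ_smul hb (by omega) hK he, smul_comm (G.f (b + 1) ^ (s + 1)),
      smul_comm (G.f (b + 1) ^ (s + 1)) (raiseCoeff n s),
      f_pow_succ_smul_eq_zero (by omega) hbd hw hew]
    simp

/-- Proposition `tech` (2):  for `λ = m ω_a`, for all
`a ≤ a' ≤ k - 2` and `0 ≤ j ≤ m`,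
`e_{a'} f_{a'+1}^{(j)} f_{a'}^{(j)} ⋯ f_a^{(j)} v_λ = 0`. -/
theorem e_kills_divided_power_chain
    (k a m a' j : ℕ) (hk : 3 ≤ k) (ha : 1 ≤ a) (hak : a ≤ k - 2) (hm : 1 ≤ m)
    (haa' : a ≤ a') (ha'k : a' ≤ k - 2) (hj : j ≤ m)
    (G : QGroup (k - 1)) (V : Type) [AddCommGroup V] [Module KK V] [Module G.U V]
    [IsScalarTower KK G.U V]
    (v : V) (hV : IsHWModule G (omWt a m) v) :
    G.e a' • fDivChain G (fun _ => j) a (a' + 1) v = 0 := by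
  have := hV.findim
  have hK : ∀ l, a < l → l ≤ k - 1 → G.K l • v = v := fun l hl hlk => by
    rw [hV.wt l (by omega) hlk, omWt, if_neg (by omega), zpow_zero, one_smul]
  rw [fDivChain_succ _ (by omega)]
  obtain rfl | hlt := haa'.eq_or_lt
  · rw [fDivChain_self]
    exact e_smul_fDiv_fDiv_smul_eq_zero ha (by omega) (hV.wt a ha (by omega))
      (hK _ (by omega) (by omega)) (hV.hw _ ha (by omega)) (hV.hw _ (by omega) (by omega)) j
  · obtain ⟨b, rfl⟩ : ∃ b, a' = b + 1 := ⟨a' - 1, by omega⟩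
    rw [fDivChain_succ _ (by omega)]
    refine e_smul_fDiv_fDiv_smul_eq_zero (by omega) (by omega)
      (K_smul_fDivChain _ hK ha (by omega) (by omega) (by omega)) ?_
      (e_smul_fDivChain_eq_zero _ hV.hw ha (by omega) (by omega) (by omega))
      (e_smul_fDivChain_eq_zero _ hV.hw ha (by omega) (by omega) (by omega)) j
    rw [K_smul_fDivChain _ hK ha (by omega) (by omega) (by omega), if_neg (by omega), zpow_zero,
      one_smul]

end QSL
end
end
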